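/- In R[GL₂(𝔽_{q²})] one has q²·e_B·e_{U⁻}·e_B = e_B + (q²−1)·e_B·s·e_B. -/

import Mathlib

open scoped MatrixGroups Matrix

noncomputable section

variable (F : Type*) [Field F]

/-- The subgroup of invertible upper triangular matrices in `GL₂(𝔽_{q²})`. -/
def upperBorel : Subgroup (GL (Fin 2) F) where
  carrier := {g | Matrix.BlockTriangular (g : Matrix (Fin 2) (Fin 2) F) id}
  one_mem' := by
    show Matrix.BlockTriangular _ id
    simp only [Units.val_one]
    exact Matrix.blockTriangular_one
  mul_mem' := by
    intro a b ha hb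
    show Matrix.BlockTriangular _ id
    simp only [Units.val_mul]
    exact Matrix.BlockTriangular.mul ha hb
  inv_mem' := by
    intro g hg
    show Matrix.BlockTriangular _ id
    rw [Matrix.coe_units_inv]
    haveI := g.invertible
    exact Matrix.blockTriangular_inv_of_blockTriangular hg

/-- The subgroup of lower unitriangular matrices in `GL₂(𝔽_{q²})`. -/
def lowerUni : Subgroup (GL (Fin 2) F) where
  carrier := {g | (g : Matrix (Fin 2) (Fin 2) F) 0 0 = 1 ∧
      (g : Matrix (Fin 2) (Fin 2) F) 1 1 = 1 ∧
      (g : Matrix (Fin 2) (Fin 2) F) 0 1 = 0}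
  one_mem' := by
    refine ⟨?_, ?_, ?_⟩ <;> simp [Matrix.one_apply]
  mul_mem' := by
    rintro a b ⟨a00, a11, a01⟩ ⟨b00, b11, b01⟩
    refine ⟨?_, ?_, ?_⟩ <;>
      simp [Units.val_mul, Matrix.mul_apply, Fin.sum_univ_two, a00, a11, a01, b00, b11, b01]
  inv_mem' := by
    rintro g ⟨g00, g11, g01⟩
    have key : (g : Matrix (Fin 2) (Fin 2) F) * ((g⁻¹ : (Matrix (Fin 2) (Fin 2) F)ˣ) :
        Matrix (Fin 2) (Fin 2) F) = 1 := by
      rw [← Units.val_mul, mul_inv_cancel, Units.val_one]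
    have e01 := congrFun (congrFun key 0) 1
    have e00 := congrFun (congrFun key 0) 0
    have e11 := congrFun (congrFun key 1) 1
    rw [Matrix.mul_apply, Fin.sum_univ_two] at e01 e00 e11
    simp only [g00, g01, g11] at e01 e00 e11
    simp only [Matrix.one_apply_ne, Matrix.one_apply_eq, one_ne_zero, Ne,
      zero_mul, add_zero, one_mul, Fin.zero_eq_one_iff] at e01 e00 e11
    have h01 : ((g⁻¹ : (Matrix (Fin 2) (Fin 2) F)ˣ) : Matrix (Fin 2) (Fin 2) F) 0 1 = 0 := by
      simpa using e01
    have h00 : ((g⁻¹ : (Matrix (Fin 2) (Fin 2) F)ˣ) : Matrix (Fin 2) (Fin 2) F) 0 0 = 1 := by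
      simpa using e00
    refine ⟨h00, ?_, h01⟩
    rw [h01, mul_zero, zero_add] at e11
    simpa using e11

/-- The idempotent `e_S = |S|⁻¹ ∑_{g ∈ S} g` in the group algebra `R[G]`. -/
def eSub (R : Type*) [CommRing R] {G : Type*} [Group G] (S : Subgroup G) :
    MonoidAlgebra R G :=
  Ring.inverse ((Nat.card S : R)) • ∑ᶠ g : S, MonoidAlgebra.of R G (g : G)

end

theorem mem_upperBorel_iff {F : Type*} [Field F] (g : GL (Fin 2) F) :
    g ∈ upperBorel F ↔ (g : Matrix (Fin 2) (Fin 2) F) 1 0 = 0 := by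
  constructor
  · intro h
    exact h (by simp)
  · intro h i j hij
    fin_cases i <;> fin_cases j <;> simp_all

/-- The lower unitriangular matrix with lower left entry `x`. -/
def lowerUniMk {F : Type*} [Field F] (x : F) : GL (Fin 2) F :=
  Matrix.GeneralLinearGroup.mkOfDetNeZero !![1, 0; x, 1] (by simp [Matrix.det_fin_two])

/-- The upper triangular matrix with diagonal entries `a`, `d` and upper right entry `b`. -/
def upperBorelMk {F : Type*} [Field F] (a d : Fˣ) (b : F) : GL (Fin 2) F :=
  Matrix.GeneralLinearGroup.mkOfDetNeZero !![(a : F), b; 0, (d : F)]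
    (by simp [Matrix.det_fin_two])

theorem upperBorelMk_mem {F : Type*} [Field F] (a d : Fˣ) (b : F) :
    upperBorelMk a d b ∈ upperBorel F := by
  simp [mem_upperBorel_iff, upperBorelMk, Matrix.GeneralLinearGroup.mkOfDetNeZero]

/-- The lower unitriangular subgroup is parametrized by the lower left entry. -/
def equivLowerUni (F : Type*) [Field F] : F ≃ lowerUni F where
  toFun x := ⟨lowerUniMk x, by
    refine ⟨?_, ?_, ?_⟩ <;> simp [lowerUniMk, Matrix.GeneralLinearGroup.mkOfDetNeZero]⟩
  invFun g := (g : GL (Fin 2) F).1 1 0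
  left_inv x := by simp [lowerUniMk, Matrix.GeneralLinearGroup.mkOfDetNeZero]
  right_inv := by
    rintro ⟨g, h00, h11, h01⟩
    ext i j
    fin_cases i <;> fin_cases j <;>
      simp [lowerUniMk, Matrix.GeneralLinearGroup.mkOfDetNeZero, h00, h11, h01]

theorem upperBorel_det {F : Type*} [Field F] (g : upperBorel F) :
    (g : GL (Fin 2) F).1 0 0 * (g : GL (Fin 2) F).1 1 1 ≠ 0 := by
  have h := (g : GL (Fin 2) F).det_ne_zero
  rw [Matrix.det_fin_two, (mem_upperBorel_iff _).1 g.2, mul_zero, sub_zero] at h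
  exact h

/-- The upper triangular subgroup is parametrized by the diagonal and upper right entries. -/
def equivUpperBorel (F : Type*) [Field F] : (Fˣ × Fˣ) × F ≃ upperBorel F where
  toFun x := ⟨upperBorelMk x.1.1 x.1.2 x.2, upperBorelMk_mem _ _ _⟩
  invFun g := ((Units.mk0 _ (left_ne_zero_of_mul (upperBorel_det g)),
    Units.mk0 _ (right_ne_zero_of_mul (upperBorel_det g))), (g : GL (Fin 2) F).1 0 1)
  left_inv x := by
    ext <;> simp [upperBorelMk, Matrix.GeneralLinearGroup.mkOfDetNeZero]
  right_inv := by
    rintro ⟨g, hg⟩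
    have h10 := (mem_upperBorel_iff _).1 hg
    ext i j
    fin_cases i <;> fin_cases j <;>
      simp [upperBorelMk, Matrix.GeneralLinearGroup.mkOfDetNeZero, h10]

theorem eSub_mul_of {R G : Type*} [CommRing R] [Group G] [Finite G] (S : Subgroup G) {g : G}
    (hg : g ∈ S) : eSub R S * MonoidAlgebra.of R G g = eSub R S := by
  have := Fintype.ofFinite S
  rw [eSub, smul_mul_assoc, finsum_eq_sum_of_fintype, Finset.sum_mul]
  congr 1
  simp_rw [← map_mul]
  exact Fintype.sum_equiv (Equiv.mulRight ⟨g, hg⟩) _ _ fun _ => rfl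

theorem of_mul_eSub {R G : Type*} [CommRing R] [Group G] [Finite G] (S : Subgroup G) {g : G}
    (hg : g ∈ S) : MonoidAlgebra.of R G g * eSub R S = eSub R S := by
  have := Fintype.ofFinite S
  rw [eSub, mul_smul_comm, finsum_eq_sum_of_fintype, Finset.mul_sum]
  congr 1
  simp_rw [← map_mul]
  exact Fintype.sum_equiv (Equiv.mulLeft ⟨g, hg⟩) _ _ fun _ => rfl

theorem eSub_mul_self {R G : Type*} [CommRing R] [Group G] [Finite G] (S : Subgroup G)
    (hS : IsUnit (Nat.card S : R)) : eSub R S * eSub R S = eSub R S := by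
  have := Fintype.ofFinite S
  nth_rw 1 [eSub]
  rw [smul_mul_assoc, finsum_eq_sum_of_fintype, Finset.sum_mul,
    Finset.sum_congr rfl fun g _ => of_mul_eSub S g.2, Finset.sum_const, Finset.card_univ,
    ← Nat.card_eq_fintype_card, ← Nat.cast_smul_eq_nsmul R, smul_smul,
    Ring.inverse_mul_cancel _ hS, one_smul]

theorem lowerUniMk_eq {F : Type*} [Field F] (x : Fˣ) (s : GL (Fin 2) F)
    (hs : (s : Matrix (Fin 2) (Fin 2) F) = !![0, 1; 1, 0]) :
    lowerUniMk (x : F) = upperBorelMk 1 1 (x : F)⁻¹ * s * upperBorelMk x (-x⁻¹) 1 := by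
  ext i j
  fin_cases i <;> fin_cases j <;>
    simp [lowerUniMk, upperBorelMk, Matrix.GeneralLinearGroup.mkOfDetNeZero, hs]

theorem eSub_mul_lowerUniMk_mul_eSub {F R : Type*} [Field F] [Finite F] [CommRing R] {x : F}
    (hx : x ≠ 0) (s : GL (Fin 2) F)
    (hs : (s : Matrix (Fin 2) (Fin 2) F) = !![0, 1; 1, 0]) :
    eSub R (upperBorel F) * MonoidAlgebra.of R _ (lowerUniMk x) * eSub R (upperBorel F) =
      eSub R (upperBorel F) * MonoidAlgebra.of R _ s * eSub R (upperBorel F) := by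
  lift x to Fˣ using hx.isUnit
  rw [lowerUniMk_eq x s hs, map_mul, map_mul, ← mul_assoc, ← mul_assoc,
    eSub_mul_of _ (upperBorelMk_mem _ _ _), mul_assoc _ _ (eSub R _),
    of_mul_eSub _ (upperBorelMk_mem _ _ _)]

theorem statement6
    {F : Type*} [Field F] [Fintype F] [DecidableEq F]
    {R : Type*} [CommRing R]
    (p k q : ℕ) (hp : Nat.Prime p) (hk : 0 < k) (hq : q = p ^ k)
    (hcard : Fintype.card F = q ^ 2)
    (hR : IsUnit ((q : R) * ((q : R) ^ 2 - 1)))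
    (s : GL (Fin 2) F)
    (hs : (s : Matrix (Fin 2) (Fin 2) F) = !![0, 1; 1, 0]) :
    let eB : MonoidAlgebra R (GL (Fin 2) F) := eSub R (upperBorel F)
    let eU : MonoidAlgebra R (GL (Fin 2) F) := eSub R (lowerUni F)
    (q : R) ^ 2 • (eB * eU * eB)
      = eB + ((q : R) ^ 2 - 1) • (eB * MonoidAlgebra.of R (GL (Fin 2) F) s * eB) := by
  intro eB eU
  have hcU : Nat.card (lowerUni F) = q ^ 2 := by
    rw [← Nat.card_congr (equivLowerUni F), Nat.card_eq_fintype_card, hcard]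
  have hcard_units : ((Fintype.card Fˣ : ℕ) : R) = (q : R) ^ 2 - 1 := by
    rw [Fintype.card_units, Nat.cast_sub Fintype.card_pos, hcard]
    simp
  have hq_unit : IsUnit ((q : R) ^ 2) := (isUnit_of_mul_isUnit_left hR).pow 2
  have hcB : IsUnit (Nat.card (upperBorel F) : R) := by
    rw [← Nat.card_congr (equivUpperBorel F), Nat.card_prod, Nat.card_prod,
      Nat.card_eq_fintype_card, Nat.card_eq_fintype_card, hcard]
    push_cast
    rw [hcard_units]
    have h := isUnit_of_mul_isUnit_right hR
    exact (h.mul h).mul hq_unit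
  have hU : (q : R) ^ 2 • eU = ∑ x : F, MonoidAlgebra.of R _ (lowerUniMk x) := by
    have := Fintype.ofFinite (lowerUni F)
    simp only [eU, eSub]
    rw [hcU, smul_smul, Nat.cast_pow, Ring.mul_inverse_cancel _ hq_unit, one_smul,
      finsum_eq_sum_of_fintype]
    exact (Fintype.sum_equiv (equivLowerUni F) _ _ fun _ => rfl).symm
  have hone : lowerUniMk (0 : F) = 1 := by
    ext i j
    fin_cases i <;> fin_cases j <;>
      simp [lowerUniMk, Matrix.GeneralLinearGroup.mkOfDetNeZero]
  rw [← smul_mul_assoc, ← mul_smul_comm, hU, Finset.mul_sum, Finset.sum_mul,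
    ← Finset.add_sum_erase _ _ (Finset.mem_univ (0 : F)), hone, map_one, mul_one,
    eSub_mul_self _ hcB,
    Finset.sum_congr rfl fun x hx =>
      eSub_mul_lowerUniMk_mul_eSub (Finset.ne_of_mem_erase hx) s hs,
    Finset.sum_const, Finset.card_erase_of_mem (Finset.mem_univ _), Finset.card_univ,
    ← Fintype.card_units, ← Nat.cast_smul_eq_nsmul R, hcard_units]
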